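/- Presentation of the derived group: the group homomorphism from the free group F(Γ × X) to G_ρ sending the generator (γ, x) to x̄^γ is surjective, and its kernel is the normal closure of the set {δ_γ(r) : r ∈ R, γ ∈ Γ}. Equivalently, G_ρ is isomorphic to the presented group ⟨Γ × X ∣ δ_γ(r), r ∈ R, γ ∈ Γ⟩ via the map induced by (γ, x) ↦ x̄^γ. -/

import Mathlib

/-- The defining relators of Crowell's derived group of the permutation
representation associated to a right action `act` of `G` on `Γ`:
`(γ, g*h) * ((γ, g) * (γ·g, h))⁻¹` for `g, h ∈ G` and `γ ∈ Γ`. -/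
def derivedRels {Γ : Type*} {G : Type*} [Group G] (act : Γ → G → Γ) :
    Set (FreeGroup (Γ × G)) :=
  {r | ∃ (γ : Γ) (g h : G),
    r = FreeGroup.of (γ, g * h) *
      (FreeGroup.of (γ, g) * FreeGroup.of (act γ g, h))⁻¹}

/-- Crowell's derived group `G_ρ`. -/
def DerivedGroup {Γ : Type*} {G : Type*} [Group G] (act : Γ → G → Γ) :=
  PresentedGroup (derivedRels act)

instance {Γ : Type*} {G : Type*} [Group G] (act : Γ → G → Γ) :
    Group (DerivedGroup act) :=
  inferInstanceAs (Group (PresentedGroup (derivedRels act)))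

/-- The generator `g^γ` of the derived group. -/
def derivedGen {Γ : Type*} {G : Type*} [Group G] (act : Γ → G → Γ)
    (γ : Γ) (g : G) : DerivedGroup act :=
  PresentedGroup.of (rels := derivedRels act) (γ, g)

/-- A crossed map `c (γ) (u * v) = c (γ) u * c (γ * p u) v` is trivial at `1`. -/
lemma crossedMap_one {F Γ M : Type*} [Group F] [Group Γ] [Group M] {p : F →* Γ}
    {c : Γ → F → M} (hc : ∀ γ u v, c γ (u * v) = c γ u * c (γ * p u) v) (γ : Γ) :
    c γ 1 = 1 := by
  simpa using hc γ 1 1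

/-- The value of a crossed map at an inverse. -/
lemma crossedMap_inv {F Γ M : Type*} [Group F] [Group Γ] [Group M] {p : F →* Γ}
    {c : Γ → F → M} (hc : ∀ γ u v, c γ (u * v) = c γ u * c (γ * p u) v) (γ : Γ) (u : F) :
    c γ u⁻¹ = (c (γ * (p u)⁻¹) u)⁻¹ := by
  have h := hc γ u⁻¹ u
  rw [inv_mul_cancel, crossedMap_one hc, map_inv] at h
  exact eq_inv_of_mul_eq_one_left h.symm

/-- Crossed maps on a free group are determined by their values on the generators. -/
lemma crossedMap_ext {X Γ M : Type*} [Group Γ] [Group M] {p : FreeGroup X →* Γ}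
    {c d : Γ → FreeGroup X → M} (hc : ∀ γ u v, c γ (u * v) = c γ u * c (γ * p u) v)
    (hd : ∀ γ u v, d γ (u * v) = d γ u * d (γ * p u) v)
    (h : ∀ γ x, c γ (FreeGroup.of x) = d γ (FreeGroup.of x)) (γ : Γ) (u : FreeGroup X) :
    c γ u = d γ u := by
  induction u generalizing γ with
  | C1 => rw [crossedMap_one hc, crossedMap_one hd]
  | of x => exact h γ x
  | inv_of x _ => rw [crossedMap_inv hc, crossedMap_inv hd, h]
  | mul u v hu hv => rw [hc, hd, hu, hv]

/-- The elements on which both `p` and every `c γ` are trivial form a subgroup. -/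
def crossedMapKer {F Γ M : Type*} [Group F] [Group Γ] [Group M] (p : F →* Γ)
    (c : Γ → F → M) (hc : ∀ γ u v, c γ (u * v) = c γ u * c (γ * p u) v) : Subgroup F where
  carrier := {u | p u = 1 ∧ ∀ γ, c γ u = 1}
  one_mem' := ⟨map_one p, crossedMap_one hc⟩
  mul_mem' := by
    rintro u v ⟨hu, hcu⟩ ⟨hv, hcv⟩
    exact ⟨by rw [map_mul, hu, hv, one_mul], fun γ => by rw [hc, hcu, hcv, one_mul]⟩
  inv_mem' := by
    rintro u ⟨hu, hcu⟩
    exact ⟨by rw [map_inv, hu, inv_one], fun γ => by rw [crossedMap_inv hc, hcu, inv_one]⟩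

lemma crossedMapKer_normal {F Γ M : Type*} [Group F] [Group Γ] [Group M] (p : F →* Γ)
    (c : Γ → F → M) (hc : ∀ γ u v, c γ (u * v) = c γ u * c (γ * p u) v) :
    (crossedMapKer p c hc).Normal where
  conj_mem := by
    rintro n ⟨hn, hcn⟩ g
    refine ⟨by simp [hn], fun γ => ?_⟩
    rw [hc, hc, hcn, crossedMap_inv hc, map_mul, hn]
    simp

/-- A crossed map on a free group that kills the relators, on which `p` is trivial as well,
depends only on the class in the presented group. -/
lemma crossedMap_eq_of_mk_eq {X Γ M : Type*} [Group Γ] [Group M] {R : Set (FreeGroup X)}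
    {p : FreeGroup X →* Γ} {c : Γ → FreeGroup X → M}
    (hc : ∀ γ u v, c γ (u * v) = c γ u * c (γ * p u) v)
    (hp : ∀ r ∈ R, p r = 1) (hR : ∀ r ∈ R, ∀ γ, c γ r = 1) {u v : FreeGroup X}
    (huv : PresentedGroup.mk R u = PresentedGroup.mk R v) (γ : Γ) : c γ u = c γ v := by
  have := crossedMapKer_normal p c hc
  have hle : Subgroup.normalClosure R ≤ crossedMapKer p c hc :=
    Subgroup.normalClosure_le_normal fun r hr => ⟨hp r hr, hR r hr⟩
  have hmem : u⁻¹ * v ∈ Subgroup.normalClosure R := QuotientGroup.eq.mp huv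
  have h := hc γ u (u⁻¹ * v)
  rw [mul_inv_cancel_left, (hle hmem).2, mul_one] at h
  exact h.symm

lemma derivedGen_mul {Γ G : Type*} [Group G] (act : Γ → G → Γ) (γ : Γ) (g h : G) :
    derivedGen act γ (g * h) = derivedGen act γ g * derivedGen act (act γ g) h := by
  have hr : PresentedGroup.mk (derivedRels act) (FreeGroup.of (γ, g * h) *
      (FreeGroup.of (γ, g) * FreeGroup.of (act γ g, h))⁻¹) = 1 :=
    PresentedGroup.one_of_mem ⟨γ, g, h, rfl⟩
  rw [map_mul, map_inv, map_mul] at hr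
  exact mul_inv_eq_one.mp hr

/-- A function respecting the defining relations induces a homomorphism on the derived group. -/
def DerivedGroup.lift {Γ G M : Type*} [Group G] [Group M] {act : Γ → G → Γ} (f : Γ → G → M)
    (hf : ∀ γ g h, f γ (g * h) = f γ g * f (act γ g) h) : DerivedGroup act →* M :=
  PresentedGroup.toGroup (f := fun q : Γ × G => f q.1 q.2) (rels := derivedRels act) (by
    rintro _ ⟨γ, g, h, rfl⟩
    simp [hf])

lemma DerivedGroup.lift_gen {Γ G M : Type*} [Group G] [Group M] {act : Γ → G → Γ}
    (f : Γ → G → M) (hf : ∀ γ g h, f γ (g * h) = f γ g * f (act γ g) h) (γ : Γ) (g : G) :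
    DerivedGroup.lift f hf (derivedGen act γ g) = f γ g :=
  PresentedGroup.toGroup.of _

lemma DerivedGroup.hom_ext {Γ G M : Type*} [Group G] [Group M] {act : Γ → G → Γ}
    {φ ψ : DerivedGroup act →* M}
    (h : ∀ γ g, φ (derivedGen act γ g) = ψ (derivedGen act γ g)) : φ = ψ :=
  PresentedGroup.ext (rels := derivedRels act) fun q => h q.1 q.2

/-- Presentation of the derived group: for `G = ⟨X ∣ R⟩` and `P : G → Γ`, the
natural map `F(Γ × X) → G_ρ`, `(γ, x) ↦ x̄^γ`, is surjective with kernel the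
normal closure of the rewritten relators `δ_γ(r)`, `r ∈ R`, `γ ∈ Γ`; hence
`G_ρ ≅ ⟨Γ × X ∣ δ_γ(r)⟩`. -/
theorem derived_presentation {X : Type*} (R : Set (FreeGroup X)) {Γ : Type*} [Group Γ]
    (P : PresentedGroup R →* Γ)
    (act : Γ → PresentedGroup R → Γ)
    (hact : ∀ (γ : Γ) (g : PresentedGroup R), act γ g = γ * P g)
    (δ : Γ → FreeGroup X → FreeGroup (Γ × X))
    (hδ_of : ∀ (γ : Γ) (x : X), δ γ (FreeGroup.of x) = FreeGroup.of (γ, x))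
    (hδ_mul : ∀ (γ : Γ) (u v : FreeGroup X),
      δ γ (u * v) = δ γ u * δ (γ * P (PresentedGroup.mk R u)) v) :
    Function.Surjective
      (FreeGroup.lift fun p : Γ × X =>
        derivedGen act p.1 (PresentedGroup.of (rels := R) p.2)) ∧
    (FreeGroup.lift fun p : Γ × X =>
        derivedGen act p.1 (PresentedGroup.of (rels := R) p.2)).ker
      = Subgroup.normalClosure {w : FreeGroup (Γ × X) | ∃ r ∈ R, ∃ γ : Γ, w = δ γ r} ∧
    ∃ e : PresentedGroup {w : FreeGroup (Γ × X) | ∃ r ∈ R, ∃ γ : Γ, w = δ γ r}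
        ≃* DerivedGroup act,
      ∀ (γ : Γ) (x : X),
        e (PresentedGroup.of (γ, x)) = derivedGen act γ (PresentedGroup.of (rels := R) x) := by
  set S := {w : FreeGroup (Γ × X) | ∃ r ∈ R, ∃ γ : Γ, w = δ γ r}
  set f : FreeGroup (Γ × X) →* DerivedGroup act := FreeGroup.lift fun p : Γ × X =>
    derivedGen act p.1 (PresentedGroup.of (rels := R) p.2) with hf
  let p : FreeGroup X →* Γ := P.comp (PresentedGroup.mk R)
  have hp : ∀ r ∈ R, p r = 1 := fun r hr => by
    simp [p, PresentedGroup.one_of_mem hr]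
  -- `f` carries the rewriting map `δ` to the generators of the derived group
  have hfδ : ∀ γ u, f (δ γ u) = derivedGen act γ (PresentedGroup.mk R u) := by
    refine crossedMap_ext (p := p) (fun γ u v => by rw [hδ_mul, map_mul]; rfl)
      (fun γ u v => by rw [map_mul, derivedGen_mul, hact]; rfl) fun γ x => ?_
    rw [hδ_of, hf, FreeGroup.lift_apply_of]
    rfl
  have hfS : ∀ w ∈ S, f w = 1 := by
    rintro _ ⟨r, hr, γ, rfl⟩
    rw [hfδ, PresentedGroup.one_of_mem hr]
    refine crossedMap_one (p := P) (c := derivedGen act) (fun γ g h => ?_) γ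
    rw [derivedGen_mul, hact]
  let φ : PresentedGroup S →* DerivedGroup act := PresentedGroup.toGroup hfS
  have hφ : ∀ w, φ (PresentedGroup.mk S w) = f w := fun w => rfl
  let c : Γ → FreeGroup X → PresentedGroup S := fun γ u => PresentedGroup.mk S (δ γ u)
  have hc : ∀ γ u v, c γ (u * v) = c γ u * c (γ * p u) v := fun γ u v => by
    simp only [c, hδ_mul, map_mul]; rfl
  have hcR : ∀ r ∈ R, ∀ γ, c γ r = 1 := fun r hr γ =>
    PresentedGroup.one_of_mem ⟨r, hr, γ, rfl⟩
  let rep : PresentedGroup R → FreeGroup X := Function.surjInv (PresentedGroup.mk_surjective R)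
  have hrep : ∀ g, PresentedGroup.mk R (rep g) = g :=
    Function.surjInv_eq (PresentedGroup.mk_surjective R)
  let ψ : DerivedGroup act →* PresentedGroup S :=
    DerivedGroup.lift (fun γ g => c γ (rep g)) fun γ g h => by
      have hpg : p (rep g) = P g := congrArg P (hrep g)
      rw [hact, ← hpg, ← hc]
      exact crossedMap_eq_of_mk_eq hc hp hcR (by rw [map_mul, hrep, hrep, hrep]) γ
  have hψφ : ψ.comp φ = MonoidHom.id _ := by
    refine PresentedGroup.ext fun q => ?_
    change ψ (f (FreeGroup.of q)) = PresentedGroup.mk S (FreeGroup.of q)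
    rw [hf, FreeGroup.lift_apply_of, DerivedGroup.lift_gen, ← hδ_of]
    exact crossedMap_eq_of_mk_eq hc hp hcR (hrep _) q.1
  have hφψ : φ.comp ψ = MonoidHom.id _ := by
    refine DerivedGroup.hom_ext fun γ g => ?_
    rw [MonoidHom.comp_apply, DerivedGroup.lift_gen, hφ, hfδ, hrep, MonoidHom.id_apply]
  let e : PresentedGroup S ≃* DerivedGroup act := φ.toMulEquiv ψ hψφ hφψ
  refine ⟨e.surjective.comp (PresentedGroup.mk_surjective S), ?_, e, fun γ x => ?_⟩
  · ext w
    rw [MonoidHom.mem_ker, ← hφ]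
    exact (map_eq_one_iff e e.injective).trans (QuotientGroup.eq_one_iff w)
  · exact PresentedGroup.toGroup.of hfS
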